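/- arXiv:2112.14365 — 2 statements merged into one kernel-verified Lean document; each statement's English description precedes it below -/
import Mathlib

section
/- Let b ≥ 2 be an integer base and let u ≥ 2 be an integer. Set m := ⌊log_b(u−1)⌋, c := ⌊u/(b^m+1)⌋, and k := u − c·(b^m+1). Then F(u) = F(k) + F((b−1)·m − k − 2), where F(t) := 0 when the integer (b−1)·m − k − 2 is negative. In addition, F(0) = 1 and F(1) = 0. -/
namespace Kaprekar

/-- Sum of the digits of `v` in base `b`. -/
def s (b v : ℕ) : ℕ := (Nat.digits b v).sum

/-- `f v = v + s v`. -/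
def f (b v : ℕ) : ℕ := v + s b v

/-- `F u` is the number of generators of `u`. -/
noncomputable def F (b u : ℕ) : ℕ := Set.ncard {v : ℕ | f b v = u}

/-- Number of generators of an integer `t` (zero when `t < 0`). -/
noncomputable def FZ (b : ℕ) (t : ℤ) : ℕ := Set.ncard {v : ℕ | (f b v : ℤ) = t}

theorem s_zero (b : ℕ) : s b 0 = 0 := by simp [s]

theorem s_add_mul {b r : ℕ} (hb : 2 ≤ b) (hr : r < b) (q : ℕ) :
    s b (r + b * q) = r + s b q := by
  rcases Nat.eq_zero_or_pos (r + b * q) with h | h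
  · have hr0 : r = 0 := by omega
    have hq0 : q = 0 := by
      have : b * q = 0 := by omega
      rcases Nat.mul_eq_zero.mp this with h | h <;> omega
    simp [hr0, hq0, s]
  · have hdiv : (r + b * q) / b = q := by
      rw [Nat.add_mul_div_left _ _ (by omega), Nat.div_eq_of_lt hr, zero_add]
    rw [s, Nat.digits_def' hb h, List.sum_cons, Nat.add_mul_mod_self_left, Nat.mod_eq_of_lt hr,
      hdiv, s]

theorem s_of_lt {b r : ℕ} (hb : 2 ≤ b) (hr : r < b) : s b r = r := by
  simpa [s_zero] using s_add_mul hb hr 0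

theorem s_pos {b v : ℕ} (hb : 2 ≤ b) (hv : 0 < v) : 0 < s b v := by
  induction v using Nat.strong_induction_on with
  | _ v ih =>
    have hs := s_add_mul hb (Nat.mod_lt v (by omega : b > 0)) (v / b)
    rw [Nat.mod_add_div] at hs
    rcases Nat.eq_zero_or_pos (v / b) with h | h
    · have := Nat.mod_add_div v b
      rw [h, mul_zero] at this
      omega
    · have := ih (v / b) (Nat.div_lt_self hv hb) h
      omega

theorem s_add_pow_mul {b w m : ℕ} (hb : 2 ≤ b) (hw : w < b ^ m) (d : ℕ) :
    s b (w + b ^ m * d) = s b w + s b d := by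
  induction m generalizing w with
  | zero =>
    obtain rfl : w = 0 := by simpa using hw
    simp [s_zero]
  | succ m ih =>
    have hr : w % b < b := Nat.mod_lt _ (by omega)
    have hq : w / b < b ^ m := Nat.div_lt_of_lt_mul (by rwa [pow_succ'] at hw)
    have hsplit : w + b ^ (m + 1) * d = w % b + b * (w / b + b ^ m * d) := by
      conv_lhs => rw [← Nat.mod_add_div w b]
      ring
    have hs := s_add_mul hb hr (w / b)
    rw [Nat.mod_add_div] at hs
    rw [hsplit, s_add_mul hb hr, ih hq, hs, add_assoc]

/-- Complementary digit strings of length `m` have digit sums adding up to `(b - 1) * m`. -/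
theorem s_add_s_compl {b m w w' : ℕ} (hb : 2 ≤ b) (h : w + w' + 1 = b ^ m) :
    s b w + s b w' + m = b * m := by
  induction m generalizing w w' with
  | zero =>
    obtain ⟨rfl, rfl⟩ : w = 0 ∧ w' = 0 := by simp at h; omega
    simp [s_zero]
  | succ m ih =>
    have hr : w % b < b := Nat.mod_lt _ (by omega)
    have hq : w / b < b ^ m := Nat.div_lt_of_lt_mul (by rw [← pow_succ']; omega)
    have hs := s_add_mul hb hr (w / b)
    obtain ⟨r', hr'⟩ := Nat.exists_eq_add_of_lt hr
    obtain ⟨q', hq'⟩ := Nat.exists_eq_add_of_lt hq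
    have hw' : w' = r' + b * q' := by
      have hw := Nat.mod_add_div w b
      have hmul : b * b ^ m = b * (w / b) + b * q' + b := by rw [hq']; ring
      rw [pow_succ'] at h
      omega
    have hs' := s_add_mul hb (show r' < b by omega) q'
    have := ih hq'.symm
    rw [Nat.mod_add_div] at hs
    rw [hw', hs, hs', mul_add]
    omega

theorem lt_of_f_lt {b v n : ℕ} (hb : 2 ≤ b) (hn : 0 < n) (h : f b v ≤ n) : v < n := by
  rcases Nat.eq_zero_or_pos v with rfl | hv
  · exact hn
  · have := s_pos hb hv
    unfold f at h
    omega

theorem finite_setOf_f_eq (b : ℕ) (t : ℤ) : {v : ℕ | (f b v : ℤ) = t}.Finite := by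
  refine (Set.finite_Iic t.toNat).subset fun v hv => ?_
  simp only [Set.mem_ofPred_eq, f, Set.mem_Iic] at hv ⊢
  omega

theorem f_add_pow_mul {b w m d : ℕ} (hb : 2 ≤ b) (hw : w < b ^ m) (hd : d < b) :
    f b (w + b ^ m * d) = f b w + d * (b ^ m + 1) := by
  rw [f, f, s_add_pow_mul hb hw, s_of_lt hb hd]
  ring

theorem f_add_f_compl {b m w w' : ℕ} (hb : 2 ≤ b) (h : w + w' + 1 = b ^ m) :
    f b w + f b w' + m + 1 = b ^ m + b * m := by
  have := s_add_s_compl hb h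
  unfold f
  omega

theorem mul_add_one_le_pow_add {b : ℕ} (hb : 2 ≤ b) (m : ℕ) : b * m + 1 ≤ b ^ m + m := by
  induction m with
  | zero => simp
  | succ m ih =>
    have := Nat.one_le_pow m b (by omega)
    rw [pow_succ']
    nlinarith

theorem setOf_f_eq {b m d k : ℕ} (hb : 2 ≤ b) (hd : d + 1 < b) (hk : k ≤ b ^ m)
    (hu : k + (d + 1) * (b ^ m + 1) ≤ b ^ (m + 1)) :
    {v | f b v = k + (d + 1) * (b ^ m + 1)} =
      (fun w => w + b ^ m * (d + 1)) '' {w | f b w = k} ∪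
      (fun w => (b ^ m - 1 - w) + b ^ m * d) ''
        {w : ℕ | (f b w : ℤ) = ((b : ℤ) - 1) * m - k - 2} := by
  have hB : 0 < b ^ m := Nat.pow_pos (by omega)
  have hbern := mul_add_one_le_pow_add hb m
  ext v
  simp only [Set.mem_ofPred_eq, Set.mem_union, Set.mem_image]
  constructor
  · intro hv
    have hlt : v < b ^ (m + 1) := lt_of_f_lt hb (Nat.pow_pos (by omega)) (hv.trans_le hu)
    have he : v / b ^ m < b := Nat.div_lt_of_lt_mul (by rwa [pow_succ] at hlt)
    have hw : v % b ^ m < b ^ m := Nat.mod_lt _ hB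
    have hsplit := Nat.mod_add_div v (b ^ m)
    rw [← hsplit, f_add_pow_mul hb hw he] at hv
    generalize v / b ^ m = e at *
    generalize v % b ^ m = w at *
    obtain ⟨w', hw'⟩ := Nat.exists_eq_add_of_lt hw
    have hcompl := f_add_f_compl hb hw'.symm
    rcases lt_trichotomy e d with h | rfl | h
    · obtain ⟨j, rfl⟩ := Nat.exists_eq_add_of_lt h
      exfalso
      nlinarith [Nat.zero_le (j * (b ^ m + 1))]
    · right
      refine ⟨w', ?_, ?_⟩
      · have : f b w = k + b ^ m + 1 := by linarith
        rw [this] at hcompl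
        zify at hcompl
        linarith
      · rw [← hsplit]
        omega
    · left
      obtain ⟨j, rfl⟩ := Nat.exists_eq_add_of_lt h
      have hj : j = 0 := by
        by_contra hj
        have : 1 * (b ^ m + 1) ≤ j * (b ^ m + 1) := Nat.mul_le_mul_right _ (by omega)
        nlinarith
      subst hj
      exact ⟨w, by simpa using hv, by simpa using hsplit⟩
  · rintro (⟨w, hw, rfl⟩ | ⟨w, hw, rfl⟩)
    · rw [f_add_pow_mul hb (lt_of_f_lt hb hB (by omega)) hd, hw]
    · have hle : f b w ≤ b ^ m := by
        zify at hbern ⊢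
        linarith
      have hwB : w < b ^ m := lt_of_f_lt hb hB hle
      have hcompl := f_add_f_compl hb (show (b ^ m - 1 - w) + w + 1 = b ^ m by omega)
      rw [f_add_pow_mul hb (by omega) (by omega)]
      zify at hcompl ⊢
      linarith

theorem F_eq_add {b m d k : ℕ} (hb : 2 ≤ b) (hd : d + 1 < b) (hk : k ≤ b ^ m)
    (hu : k + (d + 1) * (b ^ m + 1) ≤ b ^ (m + 1)) :
    F b (k + (d + 1) * (b ^ m + 1)) = F b k + FZ b (((b : ℤ) - 1) * m - k - 2) := by
  have hB : 0 < b ^ m := Nat.pow_pos (by omega)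
  have hbern := mul_add_one_le_pow_add hb m
  have hlt : ∀ w : ℕ, (f b w : ℤ) = ((b : ℤ) - 1) * m - k - 2 → w < b ^ m := fun w hw => by
    refine lt_of_f_lt hb hB ?_
    zify at hbern ⊢
    linarith
  have hfin : {w | f b w = k}.Finite := by simpa using finite_setOf_f_eq b k
  rw [F, setOf_f_eq hb hd hk hu, Set.ncard_union_eq _ (hfin.image _)
    ((finite_setOf_f_eq b _).image _), Set.ncard_image_of_injective,
    Set.InjOn.ncard_image, F, FZ]
  · intro x hx y hy hxy
    have := hlt x hx
    have := hlt y hy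
    simp only at hxy
    omega
  · exact fun x y hxy => by simpa using hxy
  · rw [Set.disjoint_left]
    rintro _ ⟨w, -, rfl⟩ ⟨w', -, h⟩
    simp only [mul_add, mul_one] at h
    omega

theorem F_zero (b : ℕ) : F b 0 = 1 := by
  have : {v | f b v = 0} = {0} := by
    ext v
    simp only [f, Set.mem_ofPred_eq, Set.mem_singleton_iff]
    exact ⟨fun h => by omega, fun h => by simp [h, s_zero]⟩
  rw [F, this, Set.ncard_singleton]

theorem F_one {b : ℕ} (hb : 2 ≤ b) : F b 1 = 0 := by
  have : {v | f b v = 1} = ∅ := by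
    ext v
    simp only [Set.mem_ofPred_eq, Set.mem_empty_iff_false, iff_false]
    intro h
    obtain rfl : v = 0 := by have := lt_of_f_lt hb one_pos h.le; omega
    simp [f, s_zero] at h
  rw [F, this, Set.ncard_empty]

theorem stmt7 (b u m c k : ℕ) (hb : 2 ≤ b) (hu : 2 ≤ u)
    (hm : m = Nat.log b (u - 1)) (hc : c = u / (b ^ m + 1))
    (hk : k = u - c * (b ^ m + 1)) :
    F b u = F b k + FZ b (((b : ℤ) - 1) * m - k - 2) ∧ F b 0 = 1 ∧ F b 1 = 0 := by
  refine ⟨?_, F_zero b, F_one hb⟩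
  have hlo : b ^ m ≤ u - 1 := hm ▸ Nat.pow_log_le_self b (by omega)
  have hhi : u - 1 < b ^ (m + 1) := hm ▸ Nat.lt_pow_succ_log_self hb _
  have hcpos : 0 < c := hc ▸ Nat.div_pos (by omega) (by omega)
  have hcb : c < b := by
    rw [hc]
    refine Nat.div_lt_of_lt_mul ?_
    rw [pow_succ] at hhi
    rw [add_mul]
    omega
  have hdiv := Nat.mod_add_div u (b ^ m + 1)
  have hmod := Nat.mod_lt u (show b ^ m + 1 > 0 by omega)
  rw [← hc, mul_comm] at hdiv
  obtain ⟨d, rfl⟩ := Nat.exists_eq_succ_of_ne_zero hcpos.ne'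
  have hueq : u = k + (d + 1) * (b ^ m + 1) := by
    simp only [Nat.succ_eq_add_one] at *
    omega
  conv_lhs => rw [hueq]
  refine F_eq_add hb hcb ?_ ?_
  · simp only [Nat.succ_eq_add_one] at *
    omega
  · omega

end Kaprekar
end

section
/- Let b = 3. Then for every n ≥ 1 there exists u ∈ ℕ with F(u) = n; and for every n ≥ 2, B(n) = (K(⌈n/2⌉) + K(⌊n/2⌋) + 2)/2, K(n) = 3^{B(n)} + 1 + K(⌊n/2⌋), and K(n) > 3·K(n−1). -/
namespace Kaprekar

/-- `K n` is the least `u` with exactly `n` generators. -/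
noncomputable def K (b n : ℕ) : ℕ := sInf {u : ℕ | F b u = n}

/-- `B n = ⌊log_b K(n)⌋`. -/
noncomputable def B (b n : ℕ) : ℕ := Nat.log b (K b n)

/-! ### Ternary digit sums -/

lemma s_three_eq (n : ℕ) : s 3 n = n % 3 + s 3 (n / 3) := by
  rcases Nat.eq_zero_or_pos n with rfl | h
  · simp [s]
  · simp [s, Nat.digits_def' (by norm_num : 1 < 3) h]

lemma s_three_mul_pow_add (L c w : ℕ) (hw : w < 3 ^ L) :
    s 3 (c * 3 ^ L + w) = s 3 c + s 3 w := by
  induction L generalizing w with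
  | zero =>
    obtain rfl : w = 0 := by simpa using hw
    simp [s]
  | succ L ih =>
    rw [pow_succ] at hw ⊢
    rw [s_three_eq (c * (3 ^ L * 3) + w), s_three_eq w]
    have h1 : (c * (3 ^ L * 3) + w) % 3 = w % 3 := by
      rw [← mul_assoc]; omega
    have h2 : (c * (3 ^ L * 3) + w) / 3 = c * 3 ^ L + w / 3 := by
      rw [← mul_assoc]; omega
    rw [h1, h2, ih _ (by omega)]
    omega

lemma s_three_add_s_three_of_add_eq (L v w : ℕ) (h : v + w + 1 = 3 ^ L) :
    s 3 v + s 3 w = 2 * L := by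
  induction L generalizing v w with
  | zero =>
    obtain ⟨rfl, rfl⟩ : v = 0 ∧ w = 0 := by rw [pow_zero] at h; omega
    simp [s]
  | succ L ih =>
    rw [pow_succ] at h
    have := ih (v / 3) (w / 3) (by omega)
    rw [s_three_eq v, s_three_eq w]
    omega

lemma f_three_add_f_three_of_add_eq (L v w : ℕ) (h : v + w + 1 = 3 ^ L) :
    f 3 v + f 3 w + 1 = 3 ^ L + 2 * L := by
  have := s_three_add_s_three_of_add_eq L v w h
  unfold f
  omega

lemma f_three_mul_pow_add (L c w : ℕ) (hc : c < 3) (hw : w < 3 ^ L) :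
    f 3 (c * 3 ^ L + w) = f 3 w + c * (3 ^ L + 1) := by
  have hs : s 3 c = c := by
    rw [s_three_eq, Nat.mod_eq_of_lt hc, Nat.div_eq_of_lt hc]
    simp [s]
  rw [f, f, s_three_mul_pow_add L c w hw, hs]
  ring

/-! ### Counting generators below a power of three -/

/-- The number of generators of `x` below `3 ^ L`; the argument is an integer so that it can be
shifted and reflected freely. -/
def G (L : ℕ) (x : ℤ) : ℕ := ((Finset.range (3 ^ L)).filter fun v ↦ (f 3 v : ℤ) = x).card

lemma finite_generators (u : ℕ) : {v : ℕ | f 3 v = u}.Finite :=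
  (Set.finite_Iic u).subset fun v (hv : f 3 v = u) ↦ by
    simp only [f] at hv
    simp only [Set.mem_Iic]
    omega

lemma G_le_F (L u : ℕ) : G L u ≤ F 3 u := by
  rw [G, F, ← Set.ncard_coe_finset]
  refine Set.ncard_le_ncard (fun v hv ↦ ?_) (finite_generators u)
  simp only [Finset.coe_filter, Set.mem_ofPred_eq] at hv ⊢
  exact_mod_cast hv.2

lemma G_eq_F (L u : ℕ) (h : u < 3 ^ L) : G L u = F 3 u := by
  rw [G, F, ← Set.ncard_coe_finset]
  congr 1
  ext v
  simp only [Finset.coe_filter, Set.mem_ofPred_eq, Finset.mem_range, Nat.cast_inj]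
  refine ⟨fun hv ↦ hv.2, fun hv ↦ ⟨?_, hv⟩⟩
  unfold f at hv
  omega

lemma G_reflect (L : ℕ) (x : ℤ) : G L x = G L (3 ^ L - 1 + 2 * L - x) := by
  have key : ∀ v < 3 ^ L, (f 3 v : ℤ) + f 3 (3 ^ L - 1 - v) + 1 = 3 ^ L + 2 * L := fun v hv ↦ by
    exact_mod_cast f_three_add_f_three_of_add_eq L v (3 ^ L - 1 - v) (by omega)
  refine Finset.card_nbij' (fun v ↦ 3 ^ L - 1 - v) (fun v ↦ 3 ^ L - 1 - v) ?_ ?_ ?_ ?_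
  all_goals
    intro v hv
    simp only [Finset.coe_filter, Set.mem_ofPred_eq, Finset.mem_range] at hv ⊢
    have := key v hv.1
    omega

lemma nonneg_of_G_pos {L : ℕ} {x : ℤ} (h : 0 < G L x) : 0 ≤ x := by
  obtain ⟨v, hv⟩ := Finset.card_pos.1 h
  have := (Finset.mem_filter.1 hv).2
  omega

lemma G_eq_zero_of_neg {L : ℕ} {x : ℤ} (h : x < 0) : G L x = 0 := by
  by_contra hG
  have := nonneg_of_G_pos (Nat.pos_of_ne_zero hG)
  omega

lemma card_filter_Ico_shift (L c : ℕ) (hc : c < 3) (x : ℤ) :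
    ((Finset.Ico (c * 3 ^ L) ((c + 1) * 3 ^ L)).filter fun v ↦ (f 3 v : ℤ) = x).card =
      G L (x - c * (3 ^ L + 1)) := by
  symm
  refine Finset.card_nbij' (fun v ↦ c * 3 ^ L + v) (fun v ↦ v - c * 3 ^ L) ?_ ?_ ?_ ?_
  · intro v hv
    simp only [Finset.coe_filter, Set.mem_ofPred_eq, Finset.mem_range, Finset.mem_Ico] at hv ⊢
    have := f_three_mul_pow_add L c v hc hv.1
    refine ⟨⟨by omega, by rw [add_mul]; omega⟩, ?_⟩
    rw [this]
    push_cast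
    linarith [hv.2]
  · intro v hv
    simp only [Finset.coe_filter, Set.mem_ofPred_eq, Finset.mem_range, Finset.mem_Ico,
      add_mul, one_mul] at hv ⊢
    have := f_three_mul_pow_add L c (v - c * 3 ^ L) hc (by omega)
    rw [Nat.add_sub_cancel' hv.1.1] at this
    refine ⟨by omega, ?_⟩
    rw [← hv.2, this]
    push_cast
    ring
  · intro v _
    simp
  · intro v hv
    simp only [Finset.coe_filter, Set.mem_ofPred_eq, Finset.mem_Ico] at hv ⊢
    omega

lemma G_succ (L : ℕ) (x : ℤ) :
    G (L + 1) x = G L x + G L (x - (3 ^ L + 1)) + G L (x - 2 * (3 ^ L + 1)) := by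
  have h0 := card_filter_Ico_shift L 0 (by norm_num) x
  have h1 := card_filter_Ico_shift L 1 (by norm_num) x
  have h2 := card_filter_Ico_shift L 2 (by norm_num) x
  norm_num at h0 h1 h2
  rw [← h0, ← h1, ← h2, G, ← Finset.card_union_of_disjoint, ← Finset.card_union_of_disjoint,
    ← Finset.filter_union, ← Finset.filter_union]
  · congr 2
    ext v
    simp only [Finset.mem_range, Finset.mem_union, Finset.mem_Ico, pow_succ]
    omega
  · simp only [Finset.disjoint_left, Finset.mem_union, Finset.mem_filter, Finset.mem_range,
      Finset.mem_Ico]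
    omega
  · simp only [Finset.disjoint_left, Finset.mem_filter, Finset.mem_range, Finset.mem_Ico]
    omega

lemma two_mul_lt_three_pow (L : ℕ) : 2 * L < 3 ^ L := by
  induction L with
  | zero => norm_num
  | succ L ih => rw [pow_succ]; omega

/-- Generators of `3 ^ L + r` come from generators of `r - 1` (above `3 ^ L`) and, by reflection,
of `2 * L - 1 - r` (below `3 ^ L`). -/
lemma F_three_pow_add (L r : ℕ) (hr : r < 3 ^ L + 2) (hrL : 3 ^ L + r < 3 ^ (L + 1)) :
    F 3 (3 ^ L + r) = G L (2 * L - 1 - r) + G L (r - 1) := by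
  rw [← G_eq_F (L + 1) (3 ^ L + r) hrL, G_succ, G_reflect L ((3 ^ L + r : ℕ) : ℤ),
    G_eq_zero_of_neg (x := ((3 ^ L + r : ℕ) : ℤ) - 2 * (3 ^ L + 1)), add_zero]
  · push_cast
    congr 2 <;> ring
  · push_cast
    have : (r : ℤ) < 3 ^ L + 2 := by exact_mod_cast hr
    linarith

/-! ### The recursively defined sequence of minima -/

/-- The sequence given by the recurrence of the main theorem, with `M 0 = M 1 = 0`. -/
def M (n : ℕ) : ℕ :=
  if n < 2 then 0 else 3 ^ ((M ((n + 1) / 2) + M (n / 2) + 2) / 2) + 1 + M (n / 2)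
termination_by n
decreasing_by all_goals omega

/-- The exponent of the leading power of three in `M n`. -/
def E (n : ℕ) : ℕ := (M ((n + 1) / 2) + M (n / 2) + 2) / 2

lemma M_one : M 1 = 0 := by rw [M]; simp

lemma M_eq (n : ℕ) (hn : 2 ≤ n) : M n = 3 ^ E n + 1 + M (n / 2) := by
  rw [M, if_neg (by omega), E]

lemma even_M (n : ℕ) : Even (M n) := by
  induction n using Nat.strong_induction_on with
  | _ n ih =>
    rcases lt_or_ge n 2 with hn | hn
    · rw [M, if_pos hn]; exact Even.zero
    · rw [M_eq n hn]
      exact (Odd.add_odd (Odd.pow (by decide)) odd_one).add (ih _ (by omega))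

lemma two_mul_E (n : ℕ) : 2 * E n = M ((n + 1) / 2) + M (n / 2) + 2 := by
  have := even_M ((n + 1) / 2)
  have := even_M (n / 2)
  rw [Nat.even_iff] at *
  unfold E
  omega

lemma M_growth (n : ℕ) (hn : 1 ≤ n) : 3 * M n + 4 ≤ M (n + 1) := by
  induction n using Nat.strong_induction_on with
  | _ n ih =>
    rcases hn.eq_or_lt with rfl | hn
    · rw [M_eq 2 le_rfl, E]
      norm_num [M_one]
    · have hstep : E n + 2 ≤ E (n + 1) ∧ M (n / 2) + 1 ≤ E n ∧
          M (n / 2) ≤ M ((n + 1) / 2) := by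
        have h1 := two_mul_E n
        have h2 := two_mul_E (n + 1)
        have h3 := ih (n / 2) (by omega) (by omega)
        rw [show (n + 1 + 1) / 2 = n / 2 + 1 by omega] at h2
        rcases Nat.even_or_odd' n with ⟨m, rfl | rfl⟩
        · rw [show (2 * m + 1) / 2 = 2 * m / 2 by omega] at *
          omega
        · rw [show (2 * m + 1 + 1) / 2 = (2 * m + 1) / 2 + 1 by omega] at *
          omega
      have hpow : 3 ^ (E n + 2) ≤ 3 ^ E (n + 1) := Nat.pow_le_pow_right (by norm_num) hstep.1
      have := two_mul_lt_three_pow (E n)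
      rw [M_eq n hn, M_eq (n + 1) (by omega)]
      rw [pow_add] at hpow
      omega

lemma M_le_M {a b : ℕ} (ha : 1 ≤ a) (hab : a ≤ b) : M a ≤ M b := by
  induction b, hab using Nat.le_induction with
  | base => exact le_rfl
  | succ b hab ih =>
    have := M_growth b (by omega)
    omega

lemma three_mul_M_lt {a b : ℕ} (ha : 1 ≤ a) (hab : a < b) : 3 * M a < M b := by
  have := M_growth a ha
  have := M_le_M (show 1 ≤ a + 1 by omega) hab
  omega

lemma M_halves (n a b : ℕ) (hn : 2 ≤ n) (ha : 1 ≤ a) (hb : 1 ≤ b) (hab : n ≤ a + b) :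
    M ((n + 1) / 2) + M (n / 2) < M a + M b ∨
      M ((n + 1) / 2) + M (n / 2) ≤ M a + M b ∧ M (n / 2) ≤ M b := by
  have hfc : M (n / 2) ≤ M ((n + 1) / 2) := M_le_M (by omega) (by omega)
  by_cases h1 : (n + 1) / 2 < a
  · have := three_mul_M_lt (by omega) h1
    omega
  by_cases h2 : (n + 1) / 2 < b
  · have := three_mul_M_lt (by omega) h2
    omega
  have hMb : M (n / 2) ≤ M b := M_le_M (by omega) (by omega)
  have hMa : M (n / 2) ≤ M a := M_le_M (by omega) (by omega)
  rcases (show (n + 1) / 2 ≤ a ∨ (n + 1) / 2 ≤ b by omega) with h | h <;>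
    have := M_le_M (show 1 ≤ (n + 1) / 2 by omega) h <;> omega

lemma F_M (n : ℕ) (hn : 1 ≤ n) : F 3 (M n) = n := by
  induction n using Nat.strong_induction_on with
  | _ n ih =>
    rcases hn.eq_or_lt with rfl | hn
    · rw [M_one, ← G_eq_F 0 0 (by norm_num)]
      simp [G, f, s, Finset.filter_singleton]
    · have h2 := two_mul_E n
      have h3 := two_mul_lt_three_pow (E n)
      rw [M_eq n hn, add_assoc, F_three_pow_add _ _ (by omega) (by rw [pow_succ]; omega)]
      rw [show (2 * (E n : ℤ) - 1 - ((1 + M (n / 2) : ℕ) : ℤ)) = (M ((n + 1) / 2) : ℕ) by omega,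
        show (((1 + M (n / 2) : ℕ) : ℤ) - 1) = (M (n / 2) : ℕ) by omega,
        G_eq_F _ _ (by omega), G_eq_F _ _ (by omega), ih _ (by omega) (by omega),
        ih _ (by omega) (by omega)]
      omega

lemma le_of_le_G {L m N : ℕ} {x : ℤ} (hm : 1 ≤ m) (hG : m ≤ G L x)
    (h : ∀ u : ℕ, (u : ℤ) = x → m ≤ F 3 u → N ≤ u) : (N : ℤ) ≤ x := by
  lift x to ℕ using nonneg_of_G_pos (by omega : 0 < G L x)
  exact_mod_cast h x rfl (hG.trans (G_le_F L x))

lemma M_le_of_le_F (n : ℕ) (hn : 1 ≤ n) (u : ℕ) (hu : n ≤ F 3 u) : M n ≤ u := by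
  induction n using Nat.strong_induction_on generalizing u with
  | _ n ihn =>
  induction u using Nat.strong_induction_on with
  | _ u ihu =>
  rcases hn.eq_or_lt with rfl | hn2
  · simp [M_one]
  rcases Nat.eq_zero_or_pos u with rfl | hu0
  · have := F_M 1 le_rfl
    rw [M_one] at this
    omega
  obtain ⟨L, hL1, hL2⟩ : ∃ L, 3 ^ L ≤ u ∧ u < 3 ^ (L + 1) :=
    ⟨Nat.log 3 u, Nat.pow_log_le_self 3 hu0.ne', Nat.lt_pow_succ_log_self (by norm_num) u⟩
  have h3 := two_mul_lt_three_pow L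
  obtain ⟨r, rfl⟩ := Nat.exists_eq_add_of_le hL1
  rcases lt_or_ge r (3 ^ L + 2) with hr | hr
  · rw [F_three_pow_add L r hr hL2] at hu
    generalize ha : G L (2 * L - 1 - r) = a at hu
    generalize hb : G L (r - 1) = b at hu
    by_cases han : n ≤ a
    · have := le_of_le_G (N := M n) hn (han.trans ha.ge) fun u hu h ↦ ihu u (by omega) h
      omega
    by_cases hbn : n ≤ b
    · have := le_of_le_G (N := M n) hn (hbn.trans hb.ge) fun u hu h ↦ ihu u (by omega) h
      omega
    have hMa := le_of_le_G (by omega) ha.ge fun u _ h ↦ ihn a (by omega) (by omega) u h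
    have hMb := le_of_le_G (by omega) hb.ge fun u _ h ↦ ihn b (by omega) (by omega) u h
    have hE := two_mul_E n
    have hcases := M_halves n a b hn2 (by omega) (by omega) hu
    rw [M_eq n hn2]
    rcases lt_trichotomy (E n) L with hEL | hEL | hEL
    · have hpow : 3 ^ (E n + 1) ≤ 3 ^ L := Nat.pow_le_pow_right (by norm_num) hEL
      have := two_mul_lt_three_pow (E n)
      rw [pow_succ] at hpow
      omega
    · rw [hEL]
      omega
    · omega
  · -- the leading digit of `u` is `2`, so decreasing it loses no generator
    have key : F 3 (3 ^ L + r) ≤ F 3 (r - 1) := by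
      refine le_trans ?_ (G_le_F (L + 1) (r - 1))
      rw [← G_eq_F (L + 1) _ hL2, G_succ, G_succ, G_reflect L ((3 ^ L + r : ℕ) : ℤ),
        G_eq_zero_of_neg (by push_cast; omega)]
      rw [show ((3 ^ L + r : ℕ) : ℤ) - (3 ^ L + 1) = (r - 1 : ℕ) by push_cast; omega,
        show ((3 ^ L + r : ℕ) : ℤ) - 2 * (3 ^ L + 1) = (r - 1 : ℕ) - (3 ^ L + 1) by
          push_cast; omega]
      omega
    have := ihu (r - 1) (by omega) (hu.trans key)
    omega

lemma K_eq_M (n : ℕ) (hn : 1 ≤ n) : K 3 n = M n := by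
  refine le_antisymm (Nat.sInf_le (F_M n hn)) (le_csInf ⟨_, F_M n hn⟩ fun u hu ↦ ?_)
  exact M_le_of_le_F n hn u (le_of_eq hu.symm)

lemma B_eq_E (n : ℕ) (hn : 2 ≤ n) : B 3 n = E n := by
  have h2 := two_mul_E n
  have h3 := two_mul_lt_three_pow (E n)
  rw [B, K_eq_M n (by omega), M_eq n hn]
  refine Nat.log_eq_of_pow_le_of_lt_pow (by omega) ?_
  have := M_le_M (show 1 ≤ n / 2 by omega) (show n / 2 ≤ (n + 1) / 2 by omega)
  rw [pow_succ]
  omega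

theorem stmt16 :
    (∀ n : ℕ, 1 ≤ n → ∃ u : ℕ, F 3 u = n) ∧
    ∀ n : ℕ, 2 ≤ n →
      2 * B 3 n = K 3 ((n + 1) / 2) + K 3 (n / 2) + 2 ∧
      K 3 n = 3 ^ B 3 n + 1 + K 3 (n / 2) ∧
      3 * K 3 (n - 1) < K 3 n := by
  refine ⟨fun n hn ↦ ⟨M n, F_M n hn⟩, fun n hn ↦ ?_⟩
  rw [B_eq_E n hn, K_eq_M n (by omega), K_eq_M ((n + 1) / 2) (by omega),
    K_eq_M (n / 2) (by omega), K_eq_M (n - 1) (by omega)]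
  exact ⟨two_mul_E n, M_eq n hn, three_mul_M_lt (by omega) (by omega)⟩

end Kaprekar
end
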